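/- Let S be a complete separable metric space, let κ be a Markov kernel on S that is Feller in the sense that the map x ↦ κ(x) is continuous from S to the space of Borel probability measures on S with the topology of weak convergence, and suppose there exists x₀ ∈ S such that the family of Cesàro averages { (1/n)·Σ_{k=0}^{n−1} κᵏ(x₀) : n ≥ 1 } is tight. Then κ admits an invariant probability measure. -/

import Mathlib

open MeasureTheory ProbabilityTheory

/-- The `n`-fold iterate of a Markov kernel, started at `x`:
`kiter κ 0 x = δ_x` and `kiter κ (n+1) x = (kiter κ n x).bind κ`. -/
noncomputable def kiter {S : Type*} [MeasurableSpace S] (κ : Kernel S S) :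
    ℕ → S → Measure S
  | 0, x => Measure.dirac x
  | (n + 1), x => (kiter κ n x).bind (fun y => κ y)

/-- A probability measure `μ` is invariant for the Markov kernel `κ` if
`∫ κ(x)(A) μ(dx) = μ(A)` for every measurable set `A`. -/
def Invariant {S : Type*} [MeasurableSpace S] (κ : Kernel S S) (μ : Measure S) : Prop :=
  ∀ A : Set S, MeasurableSet A → ∫⁻ x, κ x A ∂μ = μ A

open Filter Topology BoundedContinuousFunction

section KrylovBogoliubov

variable {S : Type*} [MeasurableSpace S]

instance isProbabilityMeasure_kiter (κ : Kernel S S) [IsMarkovKernel κ] (n : ℕ) (x : S) :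
    IsProbabilityMeasure (kiter κ n x) := by
  induction n with
  | zero => rw [kiter]; infer_instance
  | succ n ih => rw [kiter]; infer_instance

/-- The average of the measures `kiter κ k x` over `k ≤ n`. -/
noncomputable def cesaroMeasure (κ : Kernel S S) (x : S) (n : ℕ) : Measure S :=
  ((n + 1 : ℕ) : ENNReal)⁻¹ • ∑ k ∈ Finset.range (n + 1), kiter κ k x

instance isProbabilityMeasure_cesaroMeasure (κ : Kernel S S) [IsMarkovKernel κ] (x : S) (n : ℕ) :
    IsProbabilityMeasure (cesaroMeasure κ x n) := by
  constructor
  simp only [cesaroMeasure, Measure.smul_apply, Measure.finsetSum_apply, measure_univ,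
    Finset.sum_const, Finset.card_range, nsmul_eq_mul, mul_one, smul_eq_mul]
  exact ENNReal.inv_mul_cancel (by simp) (ENNReal.natCast_ne_top _)

variable [TopologicalSpace S] [OpensMeasurableSpace S]

lemma integral_cesaroMeasure (κ : Kernel S S) [IsMarkovKernel κ] (x : S) (n : ℕ) (g : S →ᵇ ℝ) :
    ∫ y, g y ∂(cesaroMeasure κ x n) =
      ((n + 1 : ℕ) : ℝ)⁻¹ * ∑ k ∈ Finset.range (n + 1), ∫ y, g y ∂(kiter κ k x) := by
  rw [cesaroMeasure, integral_smul_measure, integral_finsetSum_measure fun k _ ↦ g.integrable _,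
    ENNReal.toReal_inv, ENNReal.toReal_natCast, smul_eq_mul]

lemma abs_integral_le_norm (μ : Measure S) [IsProbabilityMeasure μ] (g : S →ᵇ ℝ) :
    |∫ y, g y ∂μ| ≤ ‖g‖ := by
  simpa using g.norm_integral_le_norm μ

/-- The action of a Feller kernel on bounded continuous functions. -/
noncomputable def fellerOp (κ : Kernel S S) [IsMarkovKernel κ]
    (hκ : ∀ g : S →ᵇ ℝ, Continuous fun x ↦ ∫ y, g y ∂(κ x)) (g : S →ᵇ ℝ) : S →ᵇ ℝ :=
  ofNormedAddCommGroup (fun x ↦ ∫ y, g y ∂(κ x)) (hκ g) ‖g‖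
    fun x ↦ abs_integral_le_norm (κ x) g

variable (κ : Kernel S S) [IsMarkovKernel κ]
  (hκ : ∀ g : S →ᵇ ℝ, Continuous fun x ↦ ∫ y, g y ∂(κ x))

lemma integral_fellerOp (μ : Measure S) [IsProbabilityMeasure μ] (g : S →ᵇ ℝ) :
    ∫ x, fellerOp κ hκ g x ∂μ = ∫ y, g y ∂(μ.bind κ) := by
  have h := Kernel.integral_comp (κ := Kernel.const Unit μ) (η := κ) (a := ())
    (by rw [← Measure.comp_eq_comp_const_apply]; exact g.integrable _)
  rw [Measure.comp_eq_comp_const_apply, h, Kernel.const_apply]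
  rfl

lemma integral_fellerOp_sub_integral_cesaroMeasure (x : S) (n : ℕ) (g : S →ᵇ ℝ) :
    ∫ y, fellerOp κ hκ g y ∂(cesaroMeasure κ x n) - ∫ y, g y ∂(cesaroMeasure κ x n) =
      ((n + 1 : ℕ) : ℝ)⁻¹ * (∫ y, g y ∂(kiter κ (n + 1) x) - ∫ y, g y ∂(kiter κ 0 x)) := by
  have h (k : ℕ) : ∫ y, fellerOp κ hκ g y ∂(kiter κ k x) = ∫ y, g y ∂(kiter κ (k + 1) x) :=
    integral_fellerOp κ hκ _ g
  simp_rw [integral_cesaroMeasure, h, ← mul_sub, ← Finset.sum_sub_distrib]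
  rw [Finset.sum_range_sub fun k ↦ ∫ y, g y ∂(kiter κ k x)]

lemma tendsto_integral_fellerOp_sub_integral_cesaroMeasure (x : S) (g : S →ᵇ ℝ) :
    Tendsto (fun n ↦ ∫ y, fellerOp κ hκ g y ∂(cesaroMeasure κ x n) -
      ∫ y, g y ∂(cesaroMeasure κ x n)) atTop (𝓝 0) := by
  have hlim : Tendsto (fun n : ℕ ↦ ((n + 1 : ℕ) : ℝ)⁻¹) atTop (𝓝 0) :=
    tendsto_inv_atTop_nhds_zero_nat.comp (tendsto_add_atTop_nat 1)
  simp_rw [integral_fellerOp_sub_integral_cesaroMeasure]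
  refine hlim.zero_mul_isBoundedUnder_le (isBoundedUnder_of ⟨‖g‖ + ‖g‖, fun n ↦ ?_⟩)
  refine (norm_sub_le _ _).trans ?_
  gcongr <;> exact abs_integral_le_norm _ g

end KrylovBogoliubov

lemma invariant_of_bind_eq {S : Type*} [MeasurableSpace S] {κ : Kernel S S} {μ : Measure S}
    (h : μ.bind κ = μ) : Invariant κ μ := fun A hA ↦ by
  rw [← Measure.bind_apply hA κ.aemeasurable, h]

/-- **Krylov–Bogoliubov.** If `κ` is a Feller Markov kernel on a complete
separable metric space (i.e. `x ↦ κ(x)` is continuous for the topology of weak convergence,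
equivalently `x ↦ ∫ φ dκ(x)` is continuous for every bounded continuous `φ`), and if for some
`x₀` the family of Cesàro averages `(1/n)·Σ_{k<n} κᵏ(x₀)`, `n ≥ 1`, is tight, then `κ`
admits an invariant probability measure. -/
theorem stmt14
    {S : Type*} [MetricSpace S] [CompleteSpace S] [TopologicalSpace.SeparableSpace S]
    [MeasurableSpace S] [BorelSpace S]
    (κ : Kernel S S) [IsMarkovKernel κ]
    (hFeller : ∀ φ : S → ℝ, Continuous φ → (∃ C : ℝ, ∀ z, |φ z| ≤ C) →
      Continuous (fun x => ∫ y, φ y ∂(κ x)))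
    (x₀ : S)
    (htight : ∀ ε : ENNReal, 0 < ε → ∃ K : Set S, IsCompact K ∧
      ∀ n : ℕ, 1 ≤ n →
        (n : ENNReal)⁻¹ * ∑ k ∈ Finset.range n, (kiter κ k x₀) Kᶜ ≤ ε) :
    ∃ μ : Measure S, IsProbabilityMeasure μ ∧ Invariant κ μ := by
  have hκ (g : S →ᵇ ℝ) : Continuous fun x ↦ ∫ y, g y ∂(κ x) :=
    hFeller g g.continuous ⟨‖g‖, g.norm_coe_le_norm⟩
  let P (n : ℕ) : ProbabilityMeasure S := ⟨cesaroMeasure κ x₀ n, inferInstance⟩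
  have hcomp : IsCompact (closure (Set.range P)) := by
    refine isCompact_closure_of_isTightMeasureSet
      (isTightMeasureSet_iff_exists_isCompact_measure_compl_le.2 fun ε hε ↦ ?_)
    obtain ⟨K, hK, hle⟩ := htight ε hε
    refine ⟨K, hK, ?_⟩
    rintro _ ⟨_, ⟨n, rfl⟩, rfl⟩
    simpa [P, cesaroMeasure] using hle (n + 1) n.succ_pos
  obtain ⟨μ, -, hμ⟩ := hcomp.ultrafilter_le_nhds' ((hyperfilter ℕ).map P)
    (mem_of_superset (Ultrafilter.mem_map.2 (univ_mem' Set.mem_range_self)) subset_closure)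
  have hlim (g : S →ᵇ ℝ) :
      Tendsto (fun n ↦ ∫ y, g y ∂(cesaroMeasure κ x₀ n)) (hyperfilter ℕ) (𝓝 (∫ y, g y ∂μ)) :=
    ProbabilityMeasure.tendsto_iff_forall_integral_tendsto.1 (show Tendsto P _ _ from hμ) g
  refine ⟨μ, inferInstance, invariant_of_bind_eq ?_⟩
  refine ext_of_forall_integral_eq_of_IsFiniteMeasure fun g ↦ ?_
  rw [← integral_fellerOp κ hκ, ← sub_eq_zero]
  exact tendsto_nhds_unique ((hlim (fellerOp κ hκ g)).sub (hlim g))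
    ((tendsto_integral_fellerOp_sub_integral_cesaroMeasure κ hκ x₀ g).mono_left
      Nat.hyperfilter_le_atTop)
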